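/- Let (A, B) be a co-t-structure on a triangulated category T and ω := A ∩ B. Then the following are equivalent: (1) (A, B) is bounded below; (2) B ⊆ ω~; (3) ω^∧ = B; (4) B ⊆ A^∧. -/

import Mathlib

open CategoryTheory CategoryTheory.Limits CategoryTheory.Pretriangulated

universe v u

variable (C : Type u) [Category.{v} C] [HasZeroObject C] [HasShift C ℤ]
  [Preadditive C] [∀ n : ℤ, (CategoryTheory.shiftFunctor C n).Additive]
  [Pretriangulated C]

namespace CotPaper

variable {C}

/-- The shift `X⟦n⟧` of a class of objects `X` by `n ∈ ℤ`, closed under isomorphism. -/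
def shf (X : Set C) (n : ℤ) : Set C := {Z | ∃ A ∈ X, Nonempty (Z ≅ A⟦n⟧)}

/-- `star X Y` consists of the objects `Z` fitting in a distinguished triangle
`A ⟶ Z ⟶ B ⟶ A⟦1⟧` with `A ∈ X` and `B ∈ Y`. -/
def star (X Y : Set C) : Set C :=
  {Z | ∃ (A B : C) (f : A ⟶ Z) (g : Z ⟶ B) (h : B ⟶ A⟦(1:ℤ)⟧),
    A ∈ X ∧ B ∈ Y ∧ Triangle.mk f g h ∈ distTriang C}

/-- `X^⊥ = {Z : Hom(X', Z) = 0 for all X' ∈ X}`. -/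
def rightOrth (X : Set C) : Set C := {Z | ∀ A ∈ X, ∀ f : A ⟶ Z, f = 0}

/-- `⊥X = {Z : Hom(Z, X') = 0 for all X' ∈ X}`. -/
def leftOrth (X : Set C) : Set C := {Z | ∀ B ∈ X, ∀ f : Z ⟶ B, f = 0}

/-- A class of objects is closed under isomorphisms. -/
def isoClosed (X : Set C) : Prop := ∀ ⦃A B : C⦄, A ∈ X → (A ≅ B) → B ∈ X

/-- A class of objects is closed under direct summands. -/
def summandClosed (X : Set C) : Prop :=
  ∀ ⦃W Z : C⦄, W ∈ X → (∃ (i : Z ⟶ W) (r : W ⟶ Z), i ≫ r = 𝟙 Z) → Z ∈ X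

/-- `W` is a direct sum of `A` and `B` (i.e. carries a binary biproduct structure). -/
def isDirectSum (W A B : C) : Prop :=
  ∃ (iA : A ⟶ W) (iB : B ⟶ W) (pA : W ⟶ A) (pB : W ⟶ B),
    iA ≫ pA = 𝟙 A ∧ iB ≫ pB = 𝟙 B ∧ iA ≫ pB = 0 ∧ iB ≫ pA = 0 ∧
      pA ≫ iA + pB ≫ iB = 𝟙 W

/-- An additive class of objects: it contains a zero object and is closed under
finite (binary) direct sums. -/
def addClosed (X : Set C) : Prop :=
  (∃ Z ∈ X, IsZero Z) ∧ ∀ ⦃A B W : C⦄, A ∈ X → B ∈ X → isDirectSum W A B → W ∈ X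

/-- `X = add X` : `X` is closed under isomorphisms, finite direct sums and direct summands. -/
def isAdd (X : Set C) : Prop := isoClosed X ∧ addClosed X ∧ summandClosed X

/-- A class is suspended if it is closed under `[1]` and under extensions. -/
def suspended (X : Set C) : Prop := shf X 1 ⊆ X ∧ star X X ⊆ X

/-- A class is cosuspended if it is closed under `[-1]` and under extensions. -/
def cosuspended (X : Set C) : Prop := shf X (-1) ⊆ X ∧ star X X ⊆ X

/-- `ε^∧_n(X)`: defined inductively, `ε^∧_0(X) = X` and `Z ∈ ε^∧_{n+1}(X)` iff there is a
distinguished triangle `Z⟦-1⟧ ⟶ W ⟶ A ⟶ Z` (equivalently `W ⟶ A ⟶ Z ⟶ W⟦1⟧`) with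
`W ∈ ε^∧_n(X)` and `A ∈ X`. -/
def epsHat (X : Set C) : ℕ → Set C
  | 0 => X
  | n + 1 =>
    {Z | ∃ (W A : C) (f : W ⟶ A) (g : A ⟶ Z) (h : Z ⟶ W⟦(1:ℤ)⟧),
      W ∈ epsHat X n ∧ A ∈ X ∧ Triangle.mk f g h ∈ distTriang C}

/-- `ε^∨_n(X)`: `ε^∨_0(X) = X` and `Z ∈ ε^∨_{n+1}(X)` iff there is a distinguished
triangle `Z ⟶ A ⟶ K ⟶ Z⟦1⟧` with `A ∈ X` and `K ∈ ε^∨_n(X)`. -/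
def epsCheck (X : Set C) : ℕ → Set C
  | 0 => X
  | n + 1 =>
    {Z | ∃ (A K : C) (f : Z ⟶ A) (g : A ⟶ K) (h : K ⟶ Z⟦(1:ℤ)⟧),
      A ∈ X ∧ K ∈ epsCheck X n ∧ Triangle.mk f g h ∈ distTriang C}

/-- `X^∧ := ∪_{n ≥ 0} ε^∧_n(X)`. -/
def hat (X : Set C) : Set C := ⋃ n : ℕ, epsHat X n

/-- `X^∨ := ∪_{n ≥ 0} ε^∨_n(X)`. -/
def check (X : Set C) : Set C := ⋃ n : ℕ, epsCheck X n

/-- `X~ := (X^∧)^∨`. -/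
def tilde (X : Set C) : Set C := check (hat X)

/-- `resdim_X(M) := min {n : M ∈ ε^∧_n(X)}`, with `min ∅ = ∞`. -/
noncomputable def resdim (X : Set C) (M : C) : ℕ∞ :=
  sInf {n : ℕ∞ | ∃ m : ℕ, n = (m : ℕ∞) ∧ M ∈ epsHat X m}

/-- `coresdim_X(M) := min {n : M ∈ ε^∨_n(X)}`, with `min ∅ = ∞`. -/
noncomputable def coresdim (X : Set C) (M : C) : ℕ∞ :=
  sInf {n : ℕ∞ | ∃ m : ℕ, n = (m : ℕ∞) ∧ M ∈ epsCheck X m}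

/-- `id_X(M) := min {n ∈ ℕ : Hom(-, M[i])|_X = 0 for all i > n}`, with `min ∅ = ∞`. -/
noncomputable def idDim (X : Set C) (M : C) : ℕ∞ :=
  sInf {n : ℕ∞ | ∃ m : ℕ, n = (m : ℕ∞) ∧
    ∀ i : ℤ, (m : ℤ) < i → ∀ A ∈ X, ∀ f : A ⟶ M⟦i⟧, f = 0}

/-- `pd_X(M) := min {n ∈ ℕ : Hom(M[-i], -)|_X = 0 for all i > n}`, with `min ∅ = ∞`. -/
noncomputable def pdDim (X : Set C) (M : C) : ℕ∞ :=
  sInf {n : ℕ∞ | ∃ m : ℕ, n = (m : ℕ∞) ∧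
    ∀ i : ℤ, (m : ℤ) < i → ∀ B ∈ X, ∀ f : M⟦(-i : ℤ)⟧ ⟶ B, f = 0}

/-- `id_X(Y) := sup {id_X(M) : M ∈ Y}`. -/
noncomputable def idDimSet (X Y : Set C) : ℕ∞ := ⨆ M ∈ Y, idDim X M

/-- `pd_X(Y) := sup {pd_X(M) : M ∈ Y}`. -/
noncomputable def pdDimSet (X Y : Set C) : ℕ∞ := ⨆ M ∈ Y, pdDim X M

/-- `ω` is `X`-injective: `id_X(W) = 0` for every `W ∈ ω`. -/
def xInjective (X ω : Set C) : Prop := ∀ W ∈ ω, idDim X W = 0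

/-- `ω` is `X`-projective: `pd_X(W) = 0` for every `W ∈ ω`. -/
def xProjective (X ω : Set C) : Prop := ∀ W ∈ ω, pdDim X W = 0

/-- `ω` is a weak-cogenerator in `X`: `ω ⊆ X ⊆ X[-1] * ω`. -/
def weakCogenerator (ω X : Set C) : Prop := ω ⊆ X ∧ X ⊆ star (shf X (-1)) ω

/-- `ω` is a weak-generator in `X`: `ω ⊆ X ⊆ ω * X[1]`. -/
def weakGenerator (ω X : Set C) : Prop := ω ⊆ X ∧ X ⊆ star ω (shf X 1)

/-- `ω` is silting: `Hom(W, W'[i]) = 0` for all `W, W' ∈ ω` and all `i > 0`. -/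
def silting (ω : Set C) : Prop :=
  ∀ W ∈ ω, ∀ W' ∈ ω, ∀ i : ℤ, 0 < i → ∀ f : W ⟶ W'⟦i⟧, f = 0

/-- A thick subcategory: a (full, additive, isomorphism-closed) triangulated subcategory
closed under direct summands. -/
structure IsThick (S : Set C) : Prop where
  zero : ∃ Z ∈ S, IsZero Z
  iso : isoClosed S
  shift : ∀ n : ℤ, shf S n ⊆ S
  ext : star S S ⊆ S
  summand : summandClosed S

/-- `Δ̄_T(X)`: the smallest thick subcategory containing `X`. -/
def thickClosure (X : Set C) : Set C := ⋂₀ {S : Set C | IsThick S ∧ X ⊆ S}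

/-- `U_ω`: the smallest suspended class containing `ω`. -/
def uPlus (ω : Set C) : Set C := ⋂₀ {S : Set C | suspended S ∧ ω ⊆ S}

/-- `_ωU`: the smallest cosuspended class containing `ω`. -/
def uMinus (ω : Set C) : Set C := ⋂₀ {S : Set C | cosuspended S ∧ ω ⊆ S}

/-- `_ωŪ`: the smallest cosuspended class containing `ω` closed under direct summands. -/
def uMinusBar (ω : Set C) : Set C :=
  ⋂₀ {S : Set C | cosuspended S ∧ summandClosed S ∧ ω ⊆ S}

/-- `(A, B)` is a co-t-structure on the triangulated subcategory `S` of `C`: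
`A` and `B` are full additive subcategories of `S` closed under isomorphisms and direct
summands, `A[-1] ⊆ A`, `B[1] ⊆ B`, `Hom(A[-1], B) = 0` and `S = A[-1] * B`. -/
structure IsCotStructure (S A B : Set C) : Prop where
  subA : A ⊆ S
  subB : B ⊆ S
  isoA : isoClosed A
  isoB : isoClosed B
  addA : addClosed A
  addB : addClosed B
  summandA : summandClosed A
  summandB : summandClosed B
  shiftA : shf A (-1) ⊆ A
  shiftB : shf B 1 ⊆ B
  orth : ∀ A' ∈ shf A (-1), ∀ B' ∈ B, ∀ f : A' ⟶ B', f = 0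
  decomp : S = star (shf A (-1)) B

/-- A relative Auslander-Buchweitz context on `C` : `X` is cosuspended and closed under
direct summands, `Y` is suspended, closed under direct summands and `Y ⊆ X^∧`, and
`ω := X ∩ Y` is an `X`-injective weak-cogenerator in `X`. -/
structure RelativeABContext (X Y : Set C) : Prop where
  cosusp : cosuspended X
  summandX : summandClosed X
  susp : suspended Y
  summandY : summandClosed Y
  sub : Y ⊆ hat X
  inj : xInjective X (X ∩ Y)
  wcog : weakCogenerator (X ∩ Y) X


lemma zero_of_shift {X Y X' Y' : C} (k : ℤ) (e : X⟦k⟧ ≅ X') (e' : Y⟦k⟧ ≅ Y')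
    (H : ∀ g : X' ⟶ Y', g = 0) (f : X ⟶ Y) : f = 0 := by
  have h1 := H (e.inv ≫ f⟦k⟧' ≫ e'.hom)
  have h2 : f⟦k⟧' = 0 := by
    have : f⟦k⟧' = e.hom ≫ (e.inv ≫ f⟦k⟧' ≫ e'.hom) ≫ e'.inv := by simp
    rw [this, h1]; simp
  apply (shiftFunctor C k).map_injective
  rw [h2]; simp

/-- objects with no maps to positive shifts beyond `n` -/
def LL (B : Set C) (n : ℤ) : Set C := {Z | ∀ m : ℤ, n < m → ∀ b ∈ B, ∀ f : Z ⟶ b⟦m⟧, f = 0}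

lemma LL_mono (B : Set C) {n m : ℤ} (hnm : n ≤ m) : LL B n ⊆ LL B m :=
  fun _ hZ k hk => hZ k (by omega)

lemma LL_iso (B : Set C) {n : ℤ} {X Y : C} (hX : X ∈ LL B n) (e : X ≅ Y) : Y ∈ LL B n := by
  intro m hm b hb f
  have := hX m hm b hb (e.hom ≫ f)
  rw [← e.inv_hom_id_assoc f, this, comp_zero]

lemma LL_shift (B : Set C) {n : ℤ} {Z : C} (hZ : Z ∈ LL B n) (k l : ℤ) (hl : n + k = l) :
    Z⟦k⟧ ∈ LL B l := by
  intro m hm b hb f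
  exact zero_of_shift (-k) (shiftShiftNeg Z k)
    ((shiftFunctorAdd' C m (-k) (m - k) (by omega)).symm.app b)
    (hZ (m - k) (by omega) b hb) f

lemma LL_ext2 (B : Set C) {n : ℤ} (T : Triangle C) (hT : T ∈ distTriang C)
    (h1 : T.obj₁ ∈ LL B n) (h3 : T.obj₃ ∈ LL B n) : T.obj₂ ∈ LL B n := by
  intro m hm b hb f
  obtain ⟨g, hg⟩ := T.yoneda_exact₂ hT f (h1 m hm b hb _)
  rw [hg, h3 m hm b hb g, comp_zero]

lemma LL_ext3 (B : Set C) {n : ℤ} (T : Triangle C) (hT : T ∈ distTriang C)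
    (h1 : T.obj₁ ∈ LL B (n - 1)) (h2 : T.obj₂ ∈ LL B n) : T.obj₃ ∈ LL B n :=
  LL_ext2 B T.rotate (rot_of_distTriang _ hT) h2 (LL_shift B h1 1 n (by omega))

lemma LL_ext1 (B : Set C) {n : ℤ} (T : Triangle C) (hT : T ∈ distTriang C)
    (h2 : T.obj₂ ∈ LL B n) (h3 : T.obj₃ ∈ LL B (n + 1)) : T.obj₁ ∈ LL B n :=
  LL_ext2 B T.invRotate (inv_rot_of_distTriang _ hT) (LL_shift B h3 (-1) n (by omega)) h2

section
variable {A B : Set C} (h : IsCotStructure Set.univ A B)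
include h

lemma shiftB_nat {b : C} (hb : b ∈ B) (k : ℕ) : b⟦(k : ℤ)⟧ ∈ B := by
  induction k with
  | zero => exact h.isoB hb ((shiftFunctorZero C ℤ).symm.app b)
  | succ k ih =>
    exact h.shiftB ⟨_, ih, ⟨(shiftFunctorAdd' C (k : ℤ) 1 _ (by push_cast; rfl)).app b⟩⟩

lemma decomp' (Z : C) : ∃ (a b : C) (f : a⟦(-1 : ℤ)⟧ ⟶ Z) (g : Z ⟶ b)
    (k : b ⟶ a⟦(-1 : ℤ)⟧⟦(1 : ℤ)⟧), a ∈ A ∧ b ∈ B ∧ Triangle.mk f g k ∈ distTriang C := by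
  have : Z ∈ star (shf A (-1)) B := h.decomp ▸ Set.mem_univ Z
  obtain ⟨X, b, f, g, k, ⟨a, ha, ⟨e⟩⟩, hb, hT⟩ := this
  refine ⟨a, b, e.inv ≫ f, g, k ≫ e.hom⟦1⟧', ha, hb, ?_⟩
  refine isomorphic_distinguished _ hT _ (Triangle.isoMk _ _ e.symm (Iso.refl _) (Iso.refl _) ?_ ?_ ?_)
  · change (e.inv ≫ f) ≫ 𝟙 Z = e.inv ≫ f
    exact Category.comp_id _
  · change g ≫ 𝟙 b = 𝟙 Z ≫ g
    exact (Category.comp_id _).trans (Category.id_comp _).symm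
  · change (k ≫ e.hom⟦1⟧') ≫ e.inv⟦1⟧' = 𝟙 b ≫ k
    rw [Category.assoc, ← Functor.map_comp, e.hom_inv_id, CategoryTheory.Functor.map_id, Category.comp_id,
      Category.id_comp]

lemma A_eq : A = LL B 0 := by
  ext Z
  constructor
  · intro hZ m hm b hb f
    refine zero_of_shift (-1) (Iso.refl _)
      ((shiftFunctorAdd' C m (-1) (m - 1) (by omega)).symm.app b) ?_ f
    intro g
    refine h.orth _ ⟨Z, hZ, ⟨Iso.refl _⟩⟩ _ ?_ g
    obtain ⟨k, hk⟩ := Int.eq_ofNat_of_zero_le (show 0 ≤ m - 1 by omega)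
    rw [hk]
    exact shiftB_nat h hb k
  · intro hZ
    obtain ⟨a, b, f, g, k, ha, hb, hT⟩ := decomp' h (Z⟦(-1 : ℤ)⟧)
    have hg : g = 0 := (LL_shift B hZ (-1) (-1) (by omega)) |> fun H =>
      zero_of_shift 0 ((shiftFunctorZero C ℤ).app _) (Iso.refl _)
        (H 0 (by omega) b hb) g
    obtain ⟨s, hs⟩ := Triangle.coyoneda_exact₂ _ hT (𝟙 (Z⟦(-1 : ℤ)⟧))
      (by change 𝟙 _ ≫ g = 0; rw [hg]; exact comp_zero)
    change 𝟙 _ = s ≫ f at hs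
    change _ ⟶ a⟦(-1 : ℤ)⟧ at s
    refine h.summandA ha ?_
    refine ⟨(shiftFunctor C (-1 : ℤ)).preimage s, (shiftFunctor C (-1 : ℤ)).preimage f, ?_⟩
    apply (shiftFunctor C (-1 : ℤ)).map_injective
    rw [Functor.map_comp, Functor.map_preimage, Functor.map_preimage, CategoryTheory.Functor.map_id]
    exact hs.symm

lemma shfA_eq (n : ℤ) : shf A n = LL B n := by
  ext Z
  constructor
  · rintro ⟨a, ha, ⟨e⟩⟩
    rw [A_eq h] at ha
    exact LL_iso B (LL_shift B ha n n (by omega)) e.symm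
  · intro hZ
    refine ⟨Z⟦-n⟧, ?_, ⟨(shiftNegShift Z n).symm⟩⟩
    rw [A_eq h]
    exact LL_shift B hZ (-n) 0 (by omega)

lemma B_mem {Z : C} (hZ : ∀ a ∈ A, ∀ f : a⟦(-1 : ℤ)⟧ ⟶ Z, f = 0) : Z ∈ B := by
  obtain ⟨a, b, f, g, k, ha, hb, hT⟩ := decomp' h Z
  have hf : f = 0 := hZ a ha f
  obtain ⟨s, hs⟩ := Triangle.yoneda_exact₂ _ hT (𝟙 Z)
    (by change f ≫ 𝟙 _ = 0; rw [hf]; exact zero_comp)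
  exact h.summandB hb ⟨g, s, hs.symm⟩

lemma B_ext (T : Triangle C) (hT : T ∈ distTriang C)
    (h1 : T.obj₁ ∈ B) (h3 : T.obj₃ ∈ B) : T.obj₂ ∈ B := by
  refine B_mem h fun a ha f => ?_
  obtain ⟨g, hg⟩ := T.coyoneda_exact₂ hT f (h.orth _ ⟨a, ha, ⟨Iso.refl _⟩⟩ _ h3 _)
  rw [hg, h.orth _ ⟨a, ha, ⟨Iso.refl _⟩⟩ _ h1 g, zero_comp]

lemma hat_sub : hat (A ∩ B) ⊆ B := by
  intro Z hZ
  obtain ⟨n, hn⟩ := Set.mem_iUnion.1 hZ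
  clear hZ
  induction n generalizing Z with
  | zero => exact hn.2
  | succ n ih =>
    obtain ⟨W, a, f, g, k, hW, ha, hT⟩ := hn
    exact B_ext h _ (rot_of_distTriang _ hT) ha.2 (h.shiftB ⟨W, ih hW, ⟨Iso.refl _⟩⟩)

lemma epsHat_sub (n : ℕ) : epsHat A n ⊆ LL B n := by
  induction n with
  | zero => exact (A_eq h).subset
  | succ n ih =>
    rintro Z ⟨W, a, f, g, k, hW, ha, hT⟩
    rw [A_eq h] at ha
    exact LL_ext3 B _ hT (LL_mono B (by push_cast; omega) (ih hW))
      (LL_mono B (by positivity) ha)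

lemma sub_hat (n : ℕ) : LL B n ∩ B ⊆ epsHat (A ∩ B) n := by
  induction n with
  | zero => exact fun Z hZ => ⟨(A_eq h).symm ▸ hZ.1, hZ.2⟩
  | succ n ih =>
    rintro Z ⟨hZ, hZB⟩
    obtain ⟨a, b, f, g, k, ha, hb, hT⟩ := decomp' h (Z⟦(-1 : ℤ)⟧)
    -- rotate: Z[-1] → b → a[-1][1] → Z[-1][1], again: b → a' → Z' → b[1]
    have hT2 := rot_of_distTriang _ (rot_of_distTriang _ hT)
    have haA : a⟦(-1 : ℤ)⟧⟦(1 : ℤ)⟧ ∈ A := h.isoA ha (shiftNegShift a (1 : ℤ)).symm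
    let e : Z⟦(-1 : ℤ)⟧⟦(1 : ℤ)⟧ ≅ Z := shiftNegShift Z (1 : ℤ)
    have haB : a⟦(-1 : ℤ)⟧⟦(1 : ℤ)⟧ ∈ B := B_ext h _ hT2 hb (h.isoB hZB e.symm)
    have hbL : b ∈ LL B n := LL_ext1 B _ hT2
      (LL_mono B (by positivity) ((A_eq h) ▸ haA)) (LL_iso B (by exact_mod_cast hZ) e.symm)
    refine ⟨b, a⟦(-1 : ℤ)⟧⟦(1 : ℤ)⟧, k, -f⟦1⟧' ≫ e.hom, e.inv ≫ (-g⟦1⟧'), ih ⟨hbL, hb⟩,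
      ⟨haA, haB⟩, ?_⟩
    refine isomorphic_distinguished _ hT2 _
      (Triangle.isoMk _ _ (Iso.refl _) (Iso.refl _) e.symm ?_ ?_ ?_)
    · change k ≫ 𝟙 _ = 𝟙 b ≫ k
      exact (Category.comp_id _).trans (Category.id_comp _).symm
    · change (-f⟦1⟧' ≫ e.hom) ≫ e.inv = 𝟙 _ ≫ (-f⟦1⟧')
      rw [Preadditive.neg_comp, Category.assoc, e.hom_inv_id, Category.comp_id,
        Category.id_comp]
    · change (e.inv ≫ (-g⟦1⟧')) ≫ (𝟙 b)⟦1⟧' = e.inv ≫ (-g⟦1⟧')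
      rw [CategoryTheory.Functor.map_id, Category.comp_id]

lemma bdd_of_B (H : ∀ Z ∈ B, ∃ n : ℤ, Z ∈ LL B n) : (⋃ n : ℤ, shf A n) = Set.univ := by
  refine Set.eq_univ_of_forall fun Z => ?_
  obtain ⟨a, b, f, g, k, ha, hb, hT⟩ := decomp' h Z
  obtain ⟨n, hn⟩ := H b hb
  refine Set.mem_iUnion.2 ⟨max n 0, ?_⟩
  rw [shfA_eq h]
  rw [A_eq h] at ha
  exact LL_ext2 B _ hT (LL_mono B (by omega) (LL_shift B ha (-1) (-1) (by omega)))
    (LL_mono B (by omega) hn)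

end

lemma epsHat_mono {X Y : Set C} (hXY : X ⊆ Y) (n : ℕ) : epsHat X n ⊆ epsHat Y n := by
  induction n with
  | zero => exact hXY
  | succ n ih =>
    rintro Z ⟨W, a, f, g, k, hW, ha, hT⟩
    exact ⟨W, a, f, g, k, ih hW, hXY ha, hT⟩

/-- For a co-t-structure `(A, B)` on `T` with `ω := A ∩ B`, the following
are equivalent: (1) `(A, B)` is bounded below; (2) `B ⊆ ω~`; (3) `ω^∧ = B`;
(4) `B ⊆ A^∧`. -/
theorem stmt7 (A B : Set C) (h : IsCotStructure Set.univ A B) :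
    [(⋃ n : ℤ, shf A n) = Set.univ,
     B ⊆ tilde (A ∩ B),
     hat (A ∩ B) = B,
     B ⊆ hat A].TFAE := by
  have hhat : ∀ Z ∈ hat A, ∃ n : ℤ, Z ∈ LL B n := fun Z hZ => by
    obtain ⟨n, hn⟩ := Set.mem_iUnion.1 hZ
    exact ⟨n, epsHat_sub h n hn⟩
  have hmono : hat (A ∩ B) ⊆ hat A := fun Z hZ => by
    obtain ⟨n, hn⟩ := Set.mem_iUnion.1 hZ
    exact Set.mem_iUnion.2 ⟨n, epsHat_mono Set.inter_subset_left n hn⟩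
  tfae_have 1 → 3 := by
    intro H
    refine (hat_sub h).antisymm fun Z hZ => ?_
    obtain ⟨n, hn⟩ := Set.mem_iUnion.1 (H ▸ Set.mem_univ Z)
    rw [shfA_eq h] at hn
    exact Set.mem_iUnion.2 ⟨n.toNat, sub_hat h _ ⟨LL_mono B (by omega) hn, hZ⟩⟩
  tfae_have 3 → 2 := fun H Z hZ => Set.mem_iUnion.2 ⟨0, by rw [← H] at hZ; exact hZ⟩
  tfae_have 3 → 4 := fun H Z hZ => hmono (by rw [H]; exact hZ)
  tfae_have 4 → 1 := fun H => bdd_of_B h fun Z hZ => hhat Z (H hZ)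
  tfae_have 2 → 1 := by
    refine fun H => bdd_of_B h fun Z hZ => ?_
    obtain ⟨n, hn⟩ := Set.mem_iUnion.1 (H hZ)
    clear hZ
    induction n generalizing Z with
    | zero => exact hhat Z (hmono hn)
    | succ n ih =>
      obtain ⟨a, K, f, g, k, ha, hK, hT⟩ := hn
      obtain ⟨p, hp⟩ := hhat a (hmono ha)
      obtain ⟨q, hq⟩ := ih K hK
      exact ⟨max p q, LL_ext1 B _ hT (LL_mono B (by omega) hp) (LL_mono B (by omega) hq)⟩
  tfae_finish

end CotPaper
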